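/- Let d ≥ 4 be an integer. Then 2d² - 2d + 3 does not belong to the additive submonoid S_c. -/

import Mathlib

/-- The Weierstrass semigroup `H(P)` of a point of a smooth plane curve of degree `d`
whose tangent line meets the curve with multiplicity `d-1`:
the additive submonoid of `ℕ` generated by `{(d-1) + r(d-2) : 0 ≤ r ≤ d-2}`. -/
def Hd (d : ℕ) : AddSubmonoid ℕ :=
  AddSubmonoid.closure {x : ℕ | ∃ r : ℕ, r ≤ d - 2 ∧ x = (d - 1) + r * (d - 2)}

/-- The semigroup `2H(P) + (8d-9)ℕ₀ + ⋯ + (8d-9+2(d-3)(d-2))ℕ₀` of Theorem 1.2(a)(ii). -/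
def Sa (d : ℕ) : AddSubmonoid ℕ :=
  AddSubmonoid.closure
    ({x : ℕ | ∃ h ∈ Hd d, x = 2 * h} ∪
     {x : ℕ | ∃ r : ℕ, r ≤ d - 3 ∧ x = (8 * d - 9) + 2 * r * (d - 2)})

/-- The semigroup `2H(P) + (8d-11)ℕ₀ + ⋯ + (8d-11+2(d-4)(d-2))ℕ₀` of Theorem 1.2(b)(i). -/
def Sb (d : ℕ) : AddSubmonoid ℕ :=
  AddSubmonoid.closure
    ({x : ℕ | ∃ h ∈ Hd d, x = 2 * h} ∪
     {x : ℕ | ∃ r : ℕ, r ≤ d - 4 ∧ x = (8 * d - 11) + 2 * r * (d - 2)})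

/-- The semigroup `2H(P) + (8d-9)ℕ₀ + ⋯ + (8d-9+2(d-4)(d-2))ℕ₀ + (2d²-1)ℕ₀`
of Theorem 1.2(c). -/
def Sc (d : ℕ) : AddSubmonoid ℕ :=
  AddSubmonoid.closure
    ({x : ℕ | ∃ h ∈ Hd d, x = 2 * h} ∪
     {x : ℕ | ∃ r : ℕ, r ≤ d - 4 ∧ x = (8 * d - 9) + 2 * r * (d - 2)} ∪
     {2 * d ^ 2 - 1})

/-- The set of odd gaps in case (a):
`{2s(d-1)+2t+1 : s ≤ d, t ≤ min(d-2, d-s)} ∪ {2d²-1}`. -/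
def Aset (d : ℕ) : Set ℕ :=
  {x : ℕ | ∃ s t : ℕ, s ≤ d ∧ t ≤ min (d - 2) (d - s) ∧ x = 2 * s * (d - 1) + 2 * t + 1} ∪
  {2 * d ^ 2 - 1}

/-- The set of odd gaps in case (b)(i):
`{2s(d-1)+2t-1 : s ≤ d, t ≤ min(d-2, d-s), (s,t) ≠ (0,0)} ∪ {2d²-2d+1, 2d²-3}`. -/
def Bset (d : ℕ) : Set ℕ :=
  {x : ℕ | ∃ s t : ℕ, s ≤ d ∧ t ≤ min (d - 2) (d - s) ∧ (s, t) ≠ (0, 0) ∧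
    x = 2 * s * (d - 1) + 2 * t - 1} ∪
  {2 * d ^ 2 - 2 * d + 1, 2 * d ^ 2 - 3}

/-- The set of odd gaps in case (c):
`{2s(d-1)+2t+1 : s ≤ d, t ≤ min(d-2, d-s)} ∪ {2d²-2d+3}`. -/
def Cset (d : ℕ) : Set ℕ :=
  {x : ℕ | ∃ s t : ℕ, s ≤ d ∧ t ≤ min (d - 2) (d - s) ∧ x = 2 * s * (d - 1) + 2 * t + 1} ∪
  {2 * d ^ 2 - 2 * d + 3}

lemma Hd_form (m x : ℕ) (hx : x ∈ Hd (m + 2)) :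
    ∃ k C : ℕ, x = k + m * C ∧ k ≤ C ∧ C ≤ k * (m + 1) := by
  unfold Hd at hx
  induction hx using AddSubmonoid.closure_induction with
  | mem x hx =>
    obtain ⟨r, hr, rfl⟩ := hx
    have e1 : m + 2 - 1 = m + 1 := by omega
    have e2 : m + 2 - 2 = m := by omega
    rw [e2] at hr
    refine ⟨1, 1 + r, ?_, by omega, by omega⟩
    rw [e1, e2]; ring
  | zero => exact ⟨0, 0, by simp, le_rfl, by simp⟩
  | add x y _ _ hx hy =>
    obtain ⟨k, C, rfl, h1, h2⟩ := hx
    obtain ⟨k', C', rfl, h1', h2'⟩ := hy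
    exact ⟨k + k', C + C', by ring, by omega, by linarith⟩

lemma Sc_form (m x : ℕ) (hm : 2 ≤ m) (hx : x ∈ Sc (m + 2)) :
    2 * m ^ 2 + 8 * m + 7 ≤ x ∨ ∃ n k C : ℕ, x = 7 * n + 2 * k + 2 * (m * C) ∧
      4 * n + k ≤ C ∧ C ≤ n * (m + 2) + k * (m + 1) := by
  unfold Sc at hx
  induction hx using AddSubmonoid.closure_induction with
  | mem x hx =>
    rcases hx with (⟨h, hh, rfl⟩ | ⟨r, hr, rfl⟩) | hx
    · obtain ⟨k, C, rfl, h1, h2⟩ := Hd_form m h hh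
      exact Or.inr ⟨0, k, C, by ring, by omega, by simpa using h2⟩
    · refine Or.inr ⟨1, 0, 4 + r, ?_, by omega, by omega⟩
      have e1 : 8 * (m + 2) - 9 = 8 * m + 7 := by omega
      have e2 : m + 2 - 2 = m := by omega
      rw [e1, e2]; ring
    · left
      have hx' : x = 2 * (m + 2) ^ 2 - 1 := hx
      have e : 2 * (m + 2) ^ 2 = 2 * m ^ 2 + 8 * m + 8 := by ring
      omega
  | zero => exact Or.inr ⟨0, 0, 0, by simp, le_rfl, by simp⟩
  | add x y _ _ hx hy =>
    rcases hx with hx | ⟨n, k, C, rfl, h1, h2⟩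
    · left; omega
    rcases hy with hy | ⟨n', k', C', rfl, h1', h2'⟩
    · left; omega
    exact Or.inr ⟨n + n', k + k', C + C', by ring, by omega, by linarith⟩

/-- `2d² - 2d + 3 ∉ S_c`. -/
theorem stmt_14 (d : ℕ) (hd : 4 ≤ d) : 2 * d ^ 2 - 2 * d + 3 ∉ Sc d := by
  obtain ⟨m, rfl⟩ : ∃ m, d = m + 2 := ⟨d - 2, by omega⟩
  have hm : 2 ≤ m := by omega
  intro hx
  have e : 2 * (m + 2) ^ 2 = 2 * m ^ 2 + 8 * m + 8 := by ring
  have e' : 2 * (m + 2) ^ 2 - 2 * (m + 2) + 3 = 2 * m ^ 2 + 6 * m + 7 := by omega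
  rw [e'] at hx
  rcases Sc_form m _ hm hx with h | ⟨n, k, C, h, h1, h2⟩
  · omega
  obtain ⟨q, rfl⟩ : ∃ q, n = 2 * q + 1 := ⟨n / 2, by omega⟩
  have h3 : 7 * q + k + m * C = m * (m + 3) := by
    have : m * (m + 3) = m ^ 2 + 3 * m := by ring
    omega
  have hC : C ≤ m + 3 := by
    by_contra hc
    have : m * (m + 4) ≤ m * C := Nat.mul_le_mul_left m (by omega)
    nlinarith
  obtain ⟨c, hc⟩ := Nat.exists_eq_add_of_le hC
  have h4 : 7 * q + k = m * c := by
    rw [hc, mul_add] at h3; omega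
  rcases Nat.eq_zero_or_pos c with rfl | hcp
  · have hq : q = 0 := by omega
    have hk : k = 0 := by omega
    subst hq hk
    omega
  · have : m ≤ m * c := Nat.le_mul_of_pos_right m hcp
    omega
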